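/- arXiv:1803.03070 — 2 statements merged into one kernel-verified Lean document; each statement's English description precedes it below -/
import Mathlib

section
/- Let g = s₁⋯s_k be a product of reflections in GL(V) with fixed hyperplanes H₁, …, H_k and moved lines spanned by v₁, …, v_k. If v₁, …, v_k are linearly independent, then ker(g − 1) equals the intersection H₁ ∩ ⋯ ∩ H_k. -/
/-- If each `s i` moves vectors only along `v i`, then the product of the `s i` moves vectors only
along the span of the `v i`. -/
theorem prod_ofFn_apply_sub_mem_span {F V : Type*} [Field F] [AddCommGroup V] [Module F V]
    {k : ℕ} {s : Fin k → (V ≃ₗ[F] V)} {v : Fin k → V}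
    (hs : ∀ i w, s i w - w ∈ Submodule.span F {v i}) (w : V) :
    (List.ofFn s).prod w - w ∈ Submodule.span F (Set.range v) := by
  induction k with
  | zero => simp
  | succ k ih =>
    have h_tail := ih (s := fun i => s i.succ) (v := fun i => v i.succ) fun i => hs i.succ
    have h_head := hs 0 ((List.ofFn fun i => s i.succ).prod w)
    rw [List.ofFn_succ, List.prod_cons, LinearEquiv.mul_apply, ← sub_add_sub_cancel]
    refine add_mem (Submodule.span_mono ?_ h_head) (Submodule.span_mono ?_ h_tail)
    · rintro _ rfl
      exact ⟨0, rfl⟩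
    · rintro _ ⟨i, rfl⟩
      exact ⟨i.succ, rfl⟩

/-- If each `s i` moves vectors only along `v i` and the `v i` are linearly independent, then the
product of the `s i` fixes exactly the vectors fixed by every `s i`. -/
theorem prod_ofFn_apply_eq_self_iff {F V : Type*} [Field F] [AddCommGroup V] [Module F V]
    {k : ℕ} {s : Fin k → (V ≃ₗ[F] V)} {v : Fin k → V}
    (hs : ∀ i w, s i w - w ∈ Submodule.span F {v i}) (hv : LinearIndependent F v) (w : V) :
    (List.ofFn s).prod w = w ↔ ∀ i, s i w = w := by
  induction k with
  | zero => simp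
  | succ k ih =>
    obtain ⟨hv_tail, hv_head⟩ := linearIndependent_finSucc.1 hv
    have h_iff := ih (s := fun i => s i.succ) (fun i => hs i.succ) hv_tail
    have h_tail := prod_ofFn_apply_sub_mem_span (s := fun i => s i.succ)
      (v := fun i => v i.succ) (fun i => hs i.succ) w
    rw [List.ofFn_succ, List.prod_cons, LinearEquiv.mul_apply, Fin.forall_fin_succ, ← h_iff]
    refine ⟨fun h => ?_, fun ⟨h₀, h⟩ => by rw [h, h₀]⟩
    have h_fix : (List.ofFn fun i => s i.succ).prod w = w := by
      have h_head := hs 0 ((List.ofFn fun i => s i.succ).prod w)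
      rw [h, ← neg_mem_iff, neg_sub] at h_head
      exact sub_eq_zero.1 (Submodule.disjoint_def.1
        ((Submodule.disjoint_span_singleton' (hv.ne_zero 0)).2 hv_head) _ h_tail h_head)
    rw [h_fix] at h
    exact ⟨h, h_fix⟩


open Module

/-- A reflection in `GL(V)`: an invertible linear map whose fixed space
`ker (t - 1)` has codimension 1. -/
def IsLinRefl {F V : Type*} [Field F] [AddCommGroup V] [Module F V]
    (t : V ≃ₗ[F] V) : Prop :=
  Module.finrank F (V ⧸ LinearMap.ker ((t : V →ₗ[F] V) - 1)) = 1

theorem stmt4 {F V : Type*} [Field F] [AddCommGroup V] [Module F V] [FiniteDimensional F V]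
    (k : ℕ) (s : Fin k → (V ≃ₗ[F] V)) (hs : ∀ i, IsLinRefl (s i))
    (v : Fin k → V)
    (hv : ∀ i, LinearMap.range ((s i : V →ₗ[F] V) - 1) = Submodule.span F {v i})
    (g : V ≃ₗ[F] V) (hg : g = (List.ofFn s).prod)
    (hindep : LinearIndependent F v) :
    LinearMap.ker ((g : V →ₗ[F] V) - 1) =
      ⨅ i, LinearMap.ker ((s i : V →ₗ[F] V) - 1) := by
  have h_mem : ∀ i w, s i w - w ∈ Submodule.span F {v i} := fun i w =>
    hv i ▸ LinearMap.mem_range_self ((s i : V →ₗ[F] V) - 1) w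
  ext w
  simpa [hg, Submodule.mem_iInf, sub_eq_zero] using prod_ofFn_apply_eq_self_iff h_mem hindep w
end

section
/- For every element g̃ of GA(Ṽ), the reflection length of g̃ with respect to the set of affine reflections is at least dim mov(g̃). -/
open Module Pointwise

/-- The moved space of an affine transformation. -/
def mov {F V P : Type*} [Field F] [AddCommGroup V] [Module F V] [AddTorsor V P]
    (g : P ≃ᵃ[F] P) : Set V :=
  Set.range fun x => g x -ᵥ x

/-- A reflection in the general affine group: an invertible affine transformation
whose fixed-point set is an affine hyperplane. -/
def IsAffRefl {F V P : Type*} [Field F] [AddCommGroup V] [Module F V] [AddTorsor V P]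
    (r : P ≃ᵃ[F] P) : Prop :=
  ∃ H : AffineSubspace F P, (H : Set P) = {x | r x = x} ∧
    Module.finrank F (V ⧸ H.direction) = 1

/-- Reflection length in the general affine group (`⊤` if no factorization exists). -/
noncomputable def reflLenA {F V P : Type*} [Field F] [AddCommGroup V] [Module F V]
    [AddTorsor V P] (g : P ≃ᵃ[F] P) : ℕ∞ :=
  sInf {n : ℕ∞ | ∃ l : List (P ≃ᵃ[F] P),
    (∀ r ∈ l, IsAffRefl r) ∧ l.prod = g ∧ (l.length : ℕ∞) = n}

/-- The dimension of the moved space (an affine subspace of `V`). -/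
noncomputable def movDim {F V P : Type*} [Field F] [AddCommGroup V] [Module F V]
    [AddTorsor V P] (g : P ≃ᵃ[F] P) : ℕ :=
  Module.finrank F (vectorSpan F (mov g))

section MovedSpace

variable {F V P : Type*} [Field F] [AddCommGroup V] [Module F V] [AddTorsor V P]

theorem vectorSpan_mov_le (g : P ≃ᵃ[F] P) :
    vectorSpan F (mov g) ≤ LinearMap.range ((g.linear : V →ₗ[F] V) - LinearMap.id) := by
  rw [vectorSpan_def, Submodule.span_le]
  rintro _ ⟨_, ⟨x, rfl⟩, _, ⟨y, rfl⟩, rfl⟩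
  refine ⟨x -ᵥ y, ?_⟩
  have h : g.linear (x -ᵥ y) = g x -ᵥ g y := g.toAffineMap.linearMap_vsub x y
  simp only [LinearMap.sub_apply, LinearMap.id_apply, LinearEquiv.coe_coe, h, vsub_eq_sub]
  exact (vsub_sub_vsub_comm (g x) (g y) x y)

theorem IsAffRefl.finrank_range_linear_sub_id_le [FiniteDimensional F V] {r : P ≃ᵃ[F] P}
    (hr : IsAffRefl r) :
    finrank F (LinearMap.range ((r.linear : V →ₗ[F] V) - LinearMap.id)) ≤ 1 := by
  obtain ⟨H, hH, hcodim⟩ := hr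
  have hker : H.direction ≤ LinearMap.ker ((r.linear : V →ₗ[F] V) - LinearMap.id) := by
    rw [AffineSubspace.direction, hH, vectorSpan_def, Submodule.span_le]
    rintro _ ⟨x, hx, y, hy, rfl⟩
    have h : r.linear (x -ᵥ y) = r x -ᵥ r y := r.toAffineMap.linearMap_vsub x y
    rw [Set.mem_ofPred_eq] at hx hy
    simp [h, hx, hy]
  have h₁ := Submodule.finrank_mono hker
  have h₂ := LinearMap.finrank_range_add_finrank_ker ((r.linear : V →ₗ[F] V) - LinearMap.id)
  have h₃ := H.direction.finrank_quotient_add_finrank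
  omega

theorem range_linear_mul_sub_id_le (g h : P ≃ᵃ[F] P) :
    LinearMap.range (((g * h).linear : V →ₗ[F] V) - LinearMap.id) ≤
      LinearMap.range ((g.linear : V →ₗ[F] V) - LinearMap.id) ⊔
        LinearMap.range ((h.linear : V →ₗ[F] V) - LinearMap.id) := by
  rintro _ ⟨v, rfl⟩
  have hv : (g * h).linear v = g.linear (h.linear v) := rfl
  refine Submodule.mem_sup.2 ⟨_, ⟨h.linear v, rfl⟩, _, ⟨v, rfl⟩, ?_⟩
  simp [hv]

theorem finrank_range_linear_prod_sub_id_le [FiniteDimensional F V] (l : List (P ≃ᵃ[F] P))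
    (hl : ∀ r ∈ l, IsAffRefl r) :
    finrank F (LinearMap.range ((l.prod.linear : V →ₗ[F] V) - LinearMap.id)) ≤ l.length := by
  induction l with
  | nil =>
    have h : (([] : List (P ≃ᵃ[F] P)).prod.linear : V →ₗ[F] V) - LinearMap.id = 0 :=
      sub_self LinearMap.id
    rw [h, LinearMap.range_zero, finrank_bot]
    exact Nat.zero_le _
  | cons r l ih =>
    rw [List.forall_mem_cons] at hl
    rw [List.prod_cons, List.length_cons]
    have h₁ := Submodule.finrank_mono (range_linear_mul_sub_id_le r l.prod)
    have h₂ := Submodule.finrank_add_le_finrank_add_finrank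
      (LinearMap.range ((r.linear : V →ₗ[F] V) - LinearMap.id))
      (LinearMap.range ((l.prod.linear : V →ₗ[F] V) - LinearMap.id))
    have h₃ := hl.1.finrank_range_linear_sub_id_le
    have h₄ := ih hl.2
    omega

end MovedSpace

theorem stmt13 {F V P : Type*} [Field F] [AddCommGroup V] [Module F V]
    [FiniteDimensional F V] [AddTorsor V P]
    (hdim : Nat.card F = 2 → 2 ≤ Module.finrank F V)
    (g : P ≃ᵃ[F] P) :
    (movDim g : ℕ∞) ≤ reflLenA g := by
  refine le_sInf ?_
  rintro _ ⟨l, hl, rfl, rfl⟩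
  exact Nat.cast_le.2 ((Submodule.finrank_mono (vectorSpan_mov_le l.prod)).trans
    (finrank_range_linear_prod_sub_id_le l hl))
end
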